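/- Let δ ∈ [0,1], β = (1−δ)δ(δ−2)/24, and let D = 2β·I − β·(P((123)) + P((132))) on (ℂ²)^{⊗3}. For r ∈ {0,1,2,3} let m_r = 1 if r = 2 (i.e., σ^r = Y) and m_r = 0 otherwise. Then for all r, w, v ∈ {0,1,2,3}, the Pauli coefficients y_{r,w,v} = (−1)^{m_r + m_w} · (1/8) · Tr[(σ^r ⊗ σ^w ⊗ σ^v)·D] satisfy y_{r,w,v} = 3β·δ(r,0)δ(w,0)δ(v,0) − (β/2)·(δ(r,w)δ(v,0) + (−1)^{m_w}·δ(r,0)δ(w,v) + (−1)^{m_r}·δ(w,0)δ(r,v)), where δ(·,·) is the Kronecker delta. -/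

import Mathlib

open Matrix

noncomputable section

/-- The single-qubit Pauli matrices σ⁰ = I₂, σ¹ = X, σ² = Y, σ³ = Z. -/
def pauli : Fin 4 → Matrix (Fin 2) (Fin 2) ℂ
  | 0 => !![1, 0; 0, 1]
  | 1 => !![0, 1; 1, 0]
  | 2 => !![0, -Complex.I; Complex.I, 0]
  | 3 => !![1, 0; 0, -1]

/-- Index type for (ℂ²)^{⊗3}. -/
abbrev Idx2 := Fin 3 → Fin 2

/-- The operator on (ℂ²)^{⊗3} permuting the tensor factors according to c ∈ S₃:
P(c)(v₁⊗v₂⊗v₃) = v_{c⁻¹(1)}⊗v_{c⁻¹(2)}⊗v_{c⁻¹(3)}. -/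
def Perm3 (c : Equiv.Perm (Fin 3)) : Matrix Idx2 Idx2 ℂ :=
  Matrix.of fun i j => if ∀ k, i k = j (c⁻¹ k) then 1 else 0

/-- The tensor product A ⊗ B ⊗ C as an operator on (ℂ²)^{⊗3}. -/
def kron3 (A B C : Matrix (Fin 2) (Fin 2) ℂ) : Matrix Idx2 Idx2 ℂ :=
  Matrix.of fun i j => A (i 0) (j 0) * B (i 1) (j 1) * C (i 2) (j 2)

/-- The Kronecker delta, valued in ℂ. -/
def kdel (a b : Fin 4) : ℂ := if a = b then 1 else 0

/-- The sign exponent m_r = 1 if σ^r = Y and m_r = 0 otherwise. -/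
def msgn (r : Fin 4) : ℕ := if r = 2 then 1 else 0

/-- A sum over `Idx2` as an iterated sum over the three tensor slots. -/
lemma sum_idx2 (f : Idx2 → ℂ) : ∑ i, f i = ∑ a, ∑ b, ∑ c, f ![a, b, c] := by
  rw [← (Fin.consEquiv fun _ => Fin 2).sum_comp, Fintype.sum_prod_type]
  refine Finset.sum_congr rfl fun a _ => ?_
  rw [← (finTwoArrowEquiv (Fin 2)).symm.sum_comp, Fintype.sum_prod_type]
  rfl

lemma trace_mul_perm3 (M : Matrix Idx2 Idx2 ℂ) (c : Equiv.Perm (Fin 3)) :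
    (M * Perm3 c).trace = ∑ i, M i (i ∘ ⇑c⁻¹) := by
  refine Finset.sum_congr rfl fun i _ => ?_
  have h (j : Idx2) : (∀ k, j k = i (c⁻¹ k)) ↔ j = i ∘ ⇑c⁻¹ := by
    simp [funext_iff]
  simp only [Matrix.diag_apply, Matrix.mul_apply, Perm3, Matrix.of_apply, h, mul_ite, mul_one,
    mul_zero, Finset.sum_ite_eq', Finset.mem_univ, if_true]

lemma trace_kron3 (A B C : Matrix (Fin 2) (Fin 2) ℂ) :
    (kron3 A B C).trace = A.trace * B.trace * C.trace := by
  simp only [Matrix.trace, Matrix.diag_apply, sum_idx2, kron3, Matrix.of_apply, Fin.sum_univ_two]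
  simp
  ring

lemma trace_kron3_mul_perm3_finRotate (A B C : Matrix (Fin 2) (Fin 2) ℂ) :
    (kron3 A B C * Perm3 (finRotate 3)).trace = (A * C * B).trace := by
  have h0 : (finRotate 3)⁻¹ 0 = 2 := by decide
  have h1 : (finRotate 3)⁻¹ 1 = 0 := by decide
  have h2 : (finRotate 3)⁻¹ 2 = 1 := by decide
  rw [trace_mul_perm3, sum_idx2]
  simp only [kron3, Matrix.of_apply, Function.comp_apply, h0, h1, h2, Matrix.trace,
    Matrix.diag_apply, Matrix.mul_apply, Fin.sum_univ_two]
  simp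
  ring

lemma trace_kron3_mul_perm3_finRotate_inv (A B C : Matrix (Fin 2) (Fin 2) ℂ) :
    (kron3 A B C * Perm3 (finRotate 3)⁻¹).trace = (A * B * C).trace := by
  have h0 : finRotate 3 0 = 1 := by decide
  have h1 : finRotate 3 1 = 2 := by decide
  have h2 : finRotate 3 2 = 0 := by decide
  rw [trace_mul_perm3, sum_idx2]
  simp only [inv_inv, kron3, Matrix.of_apply, Function.comp_apply, h0, h1, h2, Matrix.trace,
    Matrix.diag_apply, Matrix.mul_apply, Fin.sum_univ_two]
  simp
  ring

lemma trace_pauli (r : Fin 4) : (pauli r).trace = 2 * kdel r 0 := by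
  fin_cases r <;> simp [pauli, kdel, Matrix.trace_fin_two] <;> norm_num

/-- The symmetrized trace of three Pauli matrices; the part antisymmetric in `w`, `v` cancels. -/
lemma trace_pauli_mul_add (r w v : Fin 4) :
    (pauli r * pauli v * pauli w).trace + (pauli r * pauli w * pauli v).trace
      = 4 * (kdel r w * kdel v 0 + kdel r 0 * kdel w v + kdel w 0 * kdel r v
          - 2 * (kdel r 0 * kdel w 0 * kdel v 0)) := by
  fin_cases r <;> fin_cases w <;> fin_cases v <;>
    simp [pauli, kdel, Matrix.trace_fin_two] <;> norm_num

/-- Pauli coefficients of D = 2β·I − β·(P((123)) + P((132))):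
y_{r,w,v} = (−1)^{m_r+m_w}·(1/8)·Tr[(σ^r ⊗ σ^w ⊗ σ^v)·D]
          = 3β·δ(r,0)δ(w,0)δ(v,0)
            − (β/2)(δ(r,w)δ(v,0) + (−1)^{m_w}δ(r,0)δ(w,v) + (−1)^{m_r}δ(w,0)δ(r,v)). -/
theorem pauli_coefficients_of_D
    (δ : ℝ) (hδ : δ ∈ Set.Icc (0 : ℝ) 1) (β : ℝ)
    (hβ : β = (1 - δ) * δ * (δ - 2) / 24)
    (D : Matrix Idx2 Idx2 ℂ)
    (hD : D = (2 * β) • (1 : Matrix Idx2 Idx2 ℂ)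
        - β • (Perm3 (finRotate 3) + Perm3 (finRotate 3)⁻¹))
    (r w v : Fin 4) :
    (-1 : ℂ) ^ (msgn r + msgn w) * (8 : ℂ)⁻¹ * (kron3 (pauli r) (pauli w) (pauli v) * D).trace
      = 3 * (β : ℂ) * (kdel r 0 * kdel w 0 * kdel v 0)
        - ((β : ℂ) / 2) * (kdel r w * kdel v 0
            + (-1 : ℂ) ^ (msgn w) * kdel r 0 * kdel w v
            + (-1 : ℂ) ^ (msgn r) * kdel w 0 * kdel r v) := by
  have htrace : (kron3 (pauli r) (pauli w) (pauli v) * D).trace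
      = 2 * β * (8 * (kdel r 0 * kdel w 0 * kdel v 0))
        - β * (4 * (kdel r w * kdel v 0 + kdel r 0 * kdel w v + kdel w 0 * kdel r v
          - 2 * (kdel r 0 * kdel w 0 * kdel v 0))) := by
    rw [← trace_pauli_mul_add, hD, mul_sub, Matrix.mul_smul, Matrix.mul_smul, mul_add, mul_one,
      Matrix.trace_sub, Matrix.trace_smul, Matrix.trace_smul, Matrix.trace_add,
      trace_kron3_mul_perm3_finRotate, trace_kron3_mul_perm3_finRotate_inv, trace_kron3,
      trace_pauli, trace_pauli, trace_pauli, Complex.real_smul, Complex.real_smul]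
    push_cast
    ring
  rw [htrace]
  by_cases hr : r = 2 <;> by_cases hw : w = 2 <;> simp [msgn, kdel, hr, hw] <;> grind
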